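/- Hybrid quantum–classical Madelung transform: let m, M, ħ > 0, let V : ℝⁿ × ℝᵐ → ℝ be smooth, set H_I(q,p,x) := |p|²/(2M) + V(q,x) and L_I(q,p,x) := |p|²/(2M) − V(q,x), and let 𝒮, ℛ : ℝ × (ℝ²ⁿ × ℝᵐ) → ℝ be smooth with ℛ > 0. Define Υ(t,z,x) := ℛ(t,z,x) e^{i 𝒮(t,z,x)/ħ}. Then Υ satisfies the quantum–classical wave equation iħ ∂ₜΥ = −(L_I Υ + (ħ²/(2m)) ΔₓΥ) + iħ {H_I, Υ} if and only if ∂ₜ𝒮 + |∇ₓ𝒮|²/(2m) − (ħ²/(2m))(Δₓℛ)/ℛ = L_I + {H_I, 𝒮} and ∂ₜℛ + (1/(2mℛ)) divₓ(ℛ² ∇ₓ𝒮) = {H_I, ℛ}. -/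

import Mathlib

open Complex

noncomputable section

/-- Classical phase space `T*Q = ℝⁿ × ℝⁿ` with coordinates `z = (q, p)`. -/
abbrev PS (n : ℕ) := (Fin n → ℝ) × (Fin n → ℝ)

variable {n : ℕ}

/-- Partial derivative `∂f/∂qⁱ` of a complex-valued function on phase space. -/
noncomputable def dq (i : Fin n) (f : PS n → ℂ) (z : PS n) : ℂ :=
  fderiv ℝ f z (Pi.single i 1, 0)

/-- Partial derivative `∂f/∂pᵢ` of a complex-valued function on phase space. -/
noncomputable def dp (i : Fin n) (f : PS n → ℂ) (z : PS n) : ℂ :=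
  fderiv ℝ f z (0, Pi.single i 1)

/-- Partial derivative `∂f/∂qⁱ` of a real-valued function on phase space. -/
noncomputable def dqR (i : Fin n) (f : PS n → ℝ) (z : PS n) : ℝ :=
  fderiv ℝ f z (Pi.single i 1, 0)

/-- Partial derivative `∂f/∂pᵢ` of a real-valued function on phase space. -/
noncomputable def dpR (i : Fin n) (f : PS n → ℝ) (z : PS n) : ℝ :=
  fderiv ℝ f z (0, Pi.single i 1)

/-- Canonical Poisson bracket `{F,G} = Σᵢ (∂F/∂qⁱ ∂G/∂pᵢ − ∂F/∂pᵢ ∂G/∂qⁱ)`,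
extended ℂ-bilinearly to complex-valued functions. -/
noncomputable def pb (F G : PS n → ℂ) (z : PS n) : ℂ :=
  ∑ i, (dq i F z * dp i G z - dp i F z * dq i G z)

/-- Canonical Poisson bracket of real-valued functions. -/
noncomputable def pbR (F G : PS n → ℝ) (z : PS n) : ℝ :=
  ∑ i, (dqR i F z * dpR i G z - dpR i F z * dqR i G z)

/-- Hybrid quantum–classical coordinate space `Γ = ℝ²ⁿ × ℝᵈ`. -/
abbrev Hyb (n d : ℕ) := PS n × (Fin d → ℝ)

variable {d : ℕ}

/-- `∂f/∂qⁱ` on the hybrid space (real-valued). -/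
noncomputable def dqH (i : Fin n) (f : Hyb n d → ℝ) (w : Hyb n d) : ℝ :=
  fderiv ℝ f w ((Pi.single i 1, 0), 0)

/-- `∂f/∂pᵢ` on the hybrid space (real-valued). -/
noncomputable def dpH (i : Fin n) (f : Hyb n d → ℝ) (w : Hyb n d) : ℝ :=
  fderiv ℝ f w ((0, Pi.single i 1), 0)

/-- `∂f/∂xᵏ` on the hybrid space (real-valued). -/
noncomputable def dxH (k : Fin d) (f : Hyb n d → ℝ) (w : Hyb n d) : ℝ :=
  fderiv ℝ f w (0, Pi.single k 1)

/-- Canonical Poisson bracket in the phase-space variables `z = (q,p)` only,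
pointwise in the quantum coordinate `x`. -/
noncomputable def pbH (F G : Hyb n d → ℝ) (w : Hyb n d) : ℝ :=
  ∑ i, (dqH i F w * dpH i G w - dpH i F w * dqH i G w)

/-- Laplacian `Δₓ` in the quantum variables `x` (real-valued). -/
noncomputable def laplxH (f : Hyb n d → ℝ) (w : Hyb n d) : ℝ :=
  ∑ k, dxH k (fun w' => dxH k f w') w

/-- `∂f/∂qⁱ` on the hybrid space (complex-valued). -/
noncomputable def dqHc (i : Fin n) (f : Hyb n d → ℂ) (w : Hyb n d) : ℂ :=
  fderiv ℝ f w ((Pi.single i 1, 0), 0)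

/-- `∂f/∂pᵢ` on the hybrid space (complex-valued). -/
noncomputable def dpHc (i : Fin n) (f : Hyb n d → ℂ) (w : Hyb n d) : ℂ :=
  fderiv ℝ f w ((0, Pi.single i 1), 0)

/-- `∂f/∂xᵏ` on the hybrid space (complex-valued). -/
noncomputable def dxHc (k : Fin d) (f : Hyb n d → ℂ) (w : Hyb n d) : ℂ :=
  fderiv ℝ f w (0, Pi.single k 1)

/-- Canonical Poisson bracket in the `z` variables only (complex-valued). -/
noncomputable def pbHc (F G : Hyb n d → ℂ) (w : Hyb n d) : ℂ :=
  ∑ i, (dqHc i F w * dpHc i G w - dpHc i F w * dqHc i G w)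

/-- Laplacian `Δₓ` in the quantum variables `x` (complex-valued). -/
noncomputable def laplxHc (f : Hyb n d → ℂ) (w : Hyb n d) : ℂ :=
  ∑ k, dxHc k (fun w' => dxHc k f w') w

/-- The classical-plus-interaction Hamiltonian `H_I(q,p,x) = |p|²/(2M) + V(q,x)`. -/
noncomputable def HI (M : ℝ) (V : (Fin n → ℝ) × (Fin d → ℝ) → ℝ) (w : Hyb n d) : ℝ :=
  (∑ i, w.1.2 i ^ 2) / (2 * M) + V (w.1.1, w.2)

/-- The classical-plus-interaction Lagrangian `L_I(q,p,x) = |p|²/(2M) − V(q,x)`. -/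
noncomputable def LI (M : ℝ) (V : (Fin n → ℝ) × (Fin d → ℝ) → ℝ) (w : Hyb n d) : ℝ :=
  (∑ i, w.1.2 i ^ 2) / (2 * M) - V (w.1.1, w.2)

theorem hm_fderiv_ofReal {E : Type*} [NormedAddCommGroup E] [NormedSpace ℝ E]
    (f : E → ℝ) (w v : E) (hf : DifferentiableAt ℝ f w) :
    DifferentiableAt ℝ (fun x => (f x : ℂ)) w ∧
    fderiv ℝ (fun x => (f x : ℂ)) w v = ((fderiv ℝ f w v : ℝ) : ℂ) := by
  have h := Complex.ofRealCLM.hasFDerivAt.comp w hf.hasFDerivAt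
  have h' : HasFDerivAt (fun x => (f x : ℂ)) (Complex.ofRealCLM.comp (fderiv ℝ f w)) w := h
  refine ⟨h'.differentiableAt, ?_⟩
  rw [h'.fderiv]
  rfl

theorem hm_fderiv_polar {E : Type*} [NormedAddCommGroup E] [NormedSpace ℝ E]
    (ℏ : ℝ) (f : E → ℂ) (g : E → ℝ) (w v : E) (hf : DifferentiableAt ℝ f w)
    (hg : DifferentiableAt ℝ g w) :
    fderiv ℝ (fun x => f x * Complex.exp (Complex.I * g x / ℏ)) w v
      = (fderiv ℝ f w v + Complex.I / ℏ * f w * (fderiv ℝ g w v : ℝ))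
        * Complex.exp (Complex.I * g w / ℏ) := by
  have h1 : HasFDerivAt (fun x => (g x : ℂ)) (Complex.ofRealCLM.comp (fderiv ℝ g w)) w :=
    Complex.ofRealCLM.hasFDerivAt.comp w hg.hasFDerivAt
  have h2 : HasFDerivAt (fun x => Complex.I * (g x : ℂ) / ℏ)
      ((Complex.I / (ℏ : ℂ)) • (Complex.ofRealCLM.comp (fderiv ℝ g w))) w := by
    have := h1.const_mul (Complex.I / (ℏ : ℂ))
    refine this.congr_of_eventuallyEq (Filter.Eventually.of_forall fun x => ?_)
    simp only []
    ring
  have h3 := hf.hasFDerivAt.mul h2.cexp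
  have h4 := h3.fderiv
  have h5 := congrArg (fun L => L v) h4
  refine Eq.trans h5 ?_
  simp
  ring

theorem hm_deriv_polar (ℏ : ℝ) (f g : ℝ → ℝ) (t : ℝ) (hf : DifferentiableAt ℝ f t)
    (hg : DifferentiableAt ℝ g t) :
    deriv (fun x => (f x : ℂ) * Complex.exp (Complex.I * g x / ℏ)) t
      = ((deriv f t : ℝ) + Complex.I / ℏ * f t * (deriv g t : ℝ))
        * Complex.exp (Complex.I * g t / ℏ) := by
  obtain ⟨h1, h2⟩ := hm_fderiv_ofReal f t 1 hf
  rw [← fderiv_apply_one_eq_deriv, hm_fderiv_polar ℏ _ g t 1 h1 hg, h2]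
  simp only [fderiv_apply_one_eq_deriv]

theorem hm_fderiv_polar_real {E : Type*} [NormedAddCommGroup E] [NormedSpace ℝ E]
    (ℏ : ℝ) (f g : E → ℝ) (w v : E) (hf : DifferentiableAt ℝ f w)
    (hg : DifferentiableAt ℝ g w) :
    fderiv ℝ (fun x => (f x : ℂ) * Complex.exp (Complex.I * g x / ℏ)) w v
      = ((fderiv ℝ f w v : ℝ) + Complex.I / ℏ * f w * (fderiv ℝ g w v : ℝ))
        * Complex.exp (Complex.I * g w / ℏ) := by
  obtain ⟨h1, h2⟩ := hm_fderiv_ofReal f w v hf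
  rw [hm_fderiv_polar ℏ _ g w v h1 hg, h2]

theorem hm_smooth_dir {E : Type*} [NormedAddCommGroup E] [NormedSpace ℝ E]
    (f : E → ℝ) (v : E) (hf : ContDiff ℝ (⊤ : ℕ∞) f) :
    Differentiable ℝ (fun x => fderiv ℝ f x v) := by
  have h : ContDiff ℝ 1 (fderiv ℝ f) := hf.fderiv_right (by norm_cast)
  exact (h.differentiable (by norm_num)).clm_apply (differentiable_const v)

/-- Second directional derivative of the polar form. -/
theorem hm_second {E : Type*} [NormedAddCommGroup E] [NormedSpace ℝ E]
    (ℏ : ℝ) (f g : E → ℝ) (w v : E) (hf : ContDiff ℝ (⊤ : ℕ∞) f)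
    (hg : ContDiff ℝ (⊤ : ℕ∞) g) (hpos : f w ≠ 0) :
    fderiv ℝ (fun y => fderiv ℝ
        (fun x => (f x : ℂ) * Complex.exp (Complex.I * g x / ℏ)) y v) w v
      = (((fderiv ℝ (fun y => fderiv ℝ f y v) w v : ℝ) : ℂ)
          - 1 / ℏ ^ 2 * f w * ((fderiv ℝ g w v ^ 2 : ℝ) : ℂ)
          + Complex.I / ℏ * (1 / f w) *
            ((fderiv ℝ (fun y => f y ^ 2 * fderiv ℝ g y v) w v : ℝ) : ℂ))
        * Complex.exp (Complex.I * g w / ℏ) := by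
  have hfd : Differentiable ℝ f := hf.differentiable (by simp)
  have hgd : Differentiable ℝ g := hg.differentiable (by simp)
  have hf2 := hm_smooth_dir f v hf
  have hg2 := hm_smooth_dir g v hg
  have e1 : (fun y => fderiv ℝ
        (fun x => (f x : ℂ) * Complex.exp (Complex.I * g x / ℏ)) y v)
      = fun y => (((fderiv ℝ f y v : ℝ) : ℂ) + Complex.I / ℏ * ((f y * fderiv ℝ g y v : ℝ) : ℂ))
        * Complex.exp (Complex.I * g y / ℏ) := by
    funext y
    rw [hm_fderiv_polar_real ℏ f g y v (hfd y) (hgd y)]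
    push_cast
    ring
  rw [e1]
  obtain ⟨a1, a2⟩ := hm_fderiv_ofReal (fun y => fderiv ℝ f y v) w v (hf2 w)
  obtain ⟨b1, b2⟩ := hm_fderiv_ofReal (fun y => f y * fderiv ℝ g y v) w v ((hfd w).mul (hg2 w))
  have b3 : fderiv ℝ (fun y => f y * fderiv ℝ g y v) w v
      = f w * fderiv ℝ (fun y => fderiv ℝ g y v) w v + fderiv ℝ g w v * fderiv ℝ f w v := by
    rw [fderiv_fun_mul (hfd w) (hg2 w)]
    simp
  have b4 : fderiv ℝ (fun y => f y ^ 2 * fderiv ℝ g y v) w v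
      = f w ^ 2 * fderiv ℝ (fun y => fderiv ℝ g y v) w v
        + 2 * f w * fderiv ℝ g w v * fderiv ℝ f w v := by
    rw [fderiv_fun_mul ((hfd w).fun_pow 2) (hg2 w), fderiv_fun_pow 2 (hfd w)]
    simp
    ring
  have c := (b1.hasFDerivAt.const_mul (Complex.I / (ℏ : ℂ)))
  have c2 := (a1.hasFDerivAt.fun_add c)
  have c3 : fderiv ℝ (fun y => ((fderiv ℝ f y v : ℝ) : ℂ)
      + Complex.I / ℏ * ((f y * fderiv ℝ g y v : ℝ) : ℂ)) w v
      = ((fderiv ℝ (fun y => fderiv ℝ f y v) w v : ℝ) : ℂ) + Complex.I / ℏ *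
        ((fderiv ℝ (fun y => f y * fderiv ℝ g y v) w v : ℝ) : ℂ) := by
    refine Eq.trans (congrArg (fun L => L v) c2.fderiv) ?_
    rw [← a2, ← b2]
    rfl
  rw [hm_fderiv_polar ℏ _ g w v c2.differentiableAt (hgd w), c3, b3, b4]
  congr 1
  have hfw : (f w : ℂ) ≠ 0 := by exact_mod_cast hpos
  have hI : Complex.I ^ 2 = -1 := Complex.I_sq
  have hinv : (f w : ℂ) ^ 2 * (f w : ℂ)⁻¹ = f w := by field_simp
  have hinv1 : (f w : ℂ) * (f w : ℂ)⁻¹ = 1 := by field_simp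
  push_cast
  simp only [div_eq_mul_inv, one_mul]
  linear_combination
    ((ℏ : ℂ)⁻¹ ^ 2 * f w * (fderiv ℝ g w v : ℂ) ^ 2) * hI
    - Complex.I * (ℏ : ℂ)⁻¹ * (fderiv ℝ (fun y => fderiv ℝ g y v) w v : ℂ) * hinv
    - 2 * Complex.I * (ℏ : ℂ)⁻¹ * (fderiv ℝ g w v : ℂ) * (fderiv ℝ f w v : ℂ) * hinv1

/-- Separation of real and imaginary parts. -/
theorem hm_alg (m ℏ R Rt St L P2 LR D HR HS : ℝ) (E : ℂ) (hm : 0 < m) (hℏ : 0 < ℏ)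
    (hR : 0 < R) (hE : E ≠ 0) :
    (Complex.I * ℏ * ((Rt + Complex.I / ℏ * R * St) * E)
      = -((L : ℂ) * (R * E) + (ℏ ^ 2 / (2 * m)) *
          ((LR - 1 / ℏ ^ 2 * R * P2 + Complex.I / ℏ * (1 / R) * D) * E))
        + Complex.I * ℏ * ((HR + Complex.I / ℏ * R * HS) * E))
    ↔ (St + P2 / (2 * m) - (ℏ ^ 2 / (2 * m)) * LR / R = L + HS
      ∧ Rt + (1 / (2 * m * R)) * D = HR) := by
  have hmc : (m : ℂ) ≠ 0 := by exact_mod_cast hm.ne'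
  have hhc : (ℏ : ℂ) ≠ 0 := by exact_mod_cast hℏ.ne'
  have hRc : (R : ℂ) ≠ 0 := by exact_mod_cast hR.ne'
  have key : (Complex.I * ℏ * ((Rt + Complex.I / ℏ * R * St) * E))
      - (-((L : ℂ) * (R * E) + (ℏ ^ 2 / (2 * m)) *
          ((LR - 1 / ℏ ^ 2 * R * P2 + Complex.I / ℏ * (1 / R) * D) * E))
        + Complex.I * ℏ * ((HR + Complex.I / ℏ * R * HS) * E))
      = E * (((-R * (St + P2 / (2 * m) - (ℏ ^ 2 / (2 * m)) * LR / R - (L + HS)) : ℝ) : ℂ)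
        + ((ℏ * (Rt + (1 / (2 * m * R)) * D - HR) : ℝ) : ℂ) * Complex.I) := by
    push_cast
    field_simp
    ring_nf
    simp only [Complex.I_sq]
    ring
  rw [← sub_eq_zero, key, mul_eq_zero, or_iff_right hE, Complex.ext_iff]
  simp only [Complex.add_re, Complex.add_im, Complex.ofReal_re, Complex.ofReal_im,
    Complex.re_ofReal_mul, Complex.im_ofReal_mul, Complex.I_re, Complex.I_im, mul_zero, mul_one,
    add_zero, zero_add, Complex.zero_re, Complex.zero_im, mul_eq_zero, neg_eq_zero,
    hR.ne', hℏ.ne', false_or, sub_eq_zero]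

theorem hm_HI_diff (M : ℝ) (V : (Fin n → ℝ) × (Fin d → ℝ) → ℝ)
    (hV : ContDiff ℝ (⊤ : ℕ∞) V) : Differentiable ℝ (HI M V) := by
  have h : Differentiable ℝ V := hV.differentiable (by simp)
  unfold HI
  fun_prop

/-- Hybrid quantum–classical Madelung transform:
`Υ = ℛ e^{i𝒮/ℏ}` solves the quantum–classical wave equation
`iℏ ∂ₜΥ = −(L_I Υ + (ℏ²/2m) ΔₓΥ) + iℏ {H_I, Υ}` iff `(𝒮, ℛ)` solve the
hybrid Madelung equations. -/
theorem hybrid_madelung (n d : ℕ) (m M ℏ : ℝ) (hm : 0 < m) (hM : 0 < M) (hℏ : 0 < ℏ)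
    (V : (Fin n → ℝ) × (Fin d → ℝ) → ℝ) (hV : ContDiff ℝ (⊤ : ℕ∞) V)
    (𝒮 ℛ : ℝ × Hyb n d → ℝ)
    (h𝒮 : ContDiff ℝ (⊤ : ℕ∞) 𝒮) (hℛ : ContDiff ℝ (⊤ : ℕ∞) ℛ)
    (hpos : ∀ t w, 0 < ℛ (t, w)) :
    (∀ (t : ℝ) (w : Hyb n d),
        Complex.I * ℏ *
            deriv (fun s => (ℛ (s, w) : ℂ) * Complex.exp (Complex.I * 𝒮 (s, w) / ℏ)) t
          = -((LI M V w : ℂ) * ((ℛ (t, w) : ℂ) * Complex.exp (Complex.I * 𝒮 (t, w) / ℏ))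
                + (ℏ ^ 2 / (2 * m)) *
                    laplxHc (fun w' => (ℛ (t, w') : ℂ) *
                      Complex.exp (Complex.I * 𝒮 (t, w') / ℏ)) w)
            + Complex.I * ℏ *
                pbHc (fun w' => (HI M V w' : ℂ))
                  (fun w' => (ℛ (t, w') : ℂ) * Complex.exp (Complex.I * 𝒮 (t, w') / ℏ)) w)
      ↔
    (∀ (t : ℝ) (w : Hyb n d),
        (deriv (fun s => 𝒮 (s, w)) t
            + (∑ k, dxH k (fun w' => 𝒮 (t, w')) w ^ 2) / (2 * m)
            - (ℏ ^ 2 / (2 * m)) * laplxH (fun w' => ℛ (t, w')) w / ℛ (t, w)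
          = LI M V w + pbH (HI M V) (fun w' => 𝒮 (t, w')) w)
        ∧ (deriv (fun s => ℛ (s, w)) t
            + (1 / (2 * m * ℛ (t, w))) *
                (∑ k, dxH k (fun w' => ℛ (t, w') ^ 2 * dxH k (fun w'' => 𝒮 (t, w'')) w') w)
          = pbH (HI M V) (fun w' => ℛ (t, w')) w)) := by
  refine forall_congr' fun t => forall_congr' fun w => ?_
  have hS : ContDiff ℝ (⊤ : ℕ∞) (fun w' => 𝒮 (t, w')) := by fun_prop
  have hR : ContDiff ℝ (⊤ : ℕ∞) (fun w' => ℛ (t, w')) := by fun_prop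
  have hSd : Differentiable ℝ (fun w' => 𝒮 (t, w')) := hS.differentiable (by simp)
  have hRd : Differentiable ℝ (fun w' => ℛ (t, w')) := hR.differentiable (by simp)
  have hSt : Differentiable ℝ (fun s => 𝒮 (s, w)) :=
    ContDiff.differentiable (n := (⊤ : ℕ∞)) (by fun_prop) (by simp)
  have hRt : Differentiable ℝ (fun s => ℛ (s, w)) :=
    ContDiff.differentiable (n := (⊤ : ℕ∞)) (by fun_prop) (by simp)
  have eL : laplxHc (fun w' => (ℛ (t, w') : ℂ) * Complex.exp (Complex.I * 𝒮 (t, w') / ℏ)) w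
      = (((laplxH (fun w' => ℛ (t, w')) w : ℝ) : ℂ)
        - 1 / ℏ ^ 2 * (ℛ (t, w) : ℂ) * ((∑ k, dxH k (fun w' => 𝒮 (t, w')) w ^ 2 : ℝ) : ℂ)
        + Complex.I / ℏ * (1 / (ℛ (t, w) : ℂ)) *
          ((∑ k, dxH k (fun w' => ℛ (t, w') ^ 2 * dxH k (fun w'' => 𝒮 (t, w'')) w') w : ℝ) : ℂ))
        * Complex.exp (Complex.I * 𝒮 (t, w) / ℏ) := by
    unfold laplxHc laplxH
    rw [Complex.ofReal_sum, Complex.ofReal_sum, Complex.ofReal_sum, Finset.mul_sum,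
      Finset.mul_sum, ← Finset.sum_sub_distrib, ← Finset.sum_add_distrib, Finset.sum_mul]
    refine Finset.sum_congr rfl fun k _ => ?_
    exact hm_second ℏ (fun w' => ℛ (t, w')) (fun w' => 𝒮 (t, w')) w (0, Pi.single k 1) hR hS
      (hpos t w).ne'
  have eP : pbHc (fun w' => (HI M V w' : ℂ))
      (fun w' => (ℛ (t, w') : ℂ) * Complex.exp (Complex.I * 𝒮 (t, w') / ℏ)) w
      = (((pbH (HI M V) (fun w' => ℛ (t, w')) w : ℝ) : ℂ)
        + Complex.I / ℏ * (ℛ (t, w) : ℂ) * ((pbH (HI M V) (fun w' => 𝒮 (t, w')) w : ℝ) : ℂ))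
        * Complex.exp (Complex.I * 𝒮 (t, w) / ℏ) := by
    unfold pbHc pbH
    rw [Complex.ofReal_sum, Complex.ofReal_sum, Finset.mul_sum, ← Finset.sum_add_distrib,
      Finset.sum_mul]
    refine Finset.sum_congr rfl fun i _ => ?_
    unfold dqHc dpHc dqH dpH
    rw [(hm_fderiv_ofReal (HI M V) w _ (hm_HI_diff M V hV w)).2,
      (hm_fderiv_ofReal (HI M V) w _ (hm_HI_diff M V hV w)).2,
      hm_fderiv_polar_real ℏ (fun w' => ℛ (t, w')) (fun w' => 𝒮 (t, w')) w _ (hRd w) (hSd w),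
      hm_fderiv_polar_real ℏ (fun w' => ℛ (t, w')) (fun w' => 𝒮 (t, w')) w _ (hRd w) (hSd w)]
    push_cast
    ring
  rw [eL, eP, hm_deriv_polar ℏ (fun s => ℛ (s, w)) (fun s => 𝒮 (s, w)) t (hRt t) (hSt t)]
  exact hm_alg m ℏ _ _ _ _ _ _ _ _ _ _ hm hℏ (hpos t w) (Complex.exp_ne_zero _)
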